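/- arXiv:0710.3232 — 2 statements merged into one kernel-verified Lean document; each statement's English description precedes it below -/
import Mathlib

section
/- Let F_q be a finite field and H = ker zₙ ≤ V = F_qⁿ a hyperplane. The polynomials f_k^H := z_k^q − z_k zₙ^{q−1} for 1 ≤ k ≤ n−1 together with f_n^H := zₙ^{q−1} are algebraically independent, invariant under the pointwise stabilizer GL_n(F_q)_H of H, and generate the invariant ring: F_q[V]^{GL_n(F_q)_H} = F_q[f₁^H,...,fₙ^H]. -/
open MvPolynomial

abbrev GLn (F : Type*) [Field F] (n : ℕ) := (Fin n → F) ≃ₗ[F] (Fin n → F)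

variable {F : Type*} [Field F] {n : ℕ}

/-- Matrix of the contragredient action of `g` on the coordinate functions:
`g · z_i = ∑ j (actMat g i j) z_j`. -/
noncomputable def actMat (g : GLn F n) : Matrix (Fin n) (Fin n) F :=
  Matrix.of fun i j => g.symm (Pi.single j 1) i

/-- Action of `g ∈ GL(V)` on polynomials `F[V]` (contragredient action). -/
noncomputable def polyAct (g : GLn F n) : MvPolynomial (Fin n) F →ₐ[F] MvPolynomial (Fin n) F :=
  aeval fun i => ∑ j, C (actMat g i j) * X j

/-- The degree-one polynomial corresponding to a linear form on `V`. -/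
noncomputable def linToPoly (z : (Fin n → F) →ₗ[F] F) : MvPolynomial (Fin n) F :=
  ∑ j, C (z (Pi.single j 1)) * X j

/-- The invariant ring `F[V]^G` as a subalgebra of `F[V]`. -/
noncomputable def invSub (G : Subgroup (GLn F n)) : Subalgebra F (MvPolynomial (Fin n) F) where
  carrier := {f | ∀ g ∈ G, polyAct g f = f}
  add_mem' := fun {a b} ha hb g hg => by rw [map_add, ha g hg, hb g hg]
  mul_mem' := fun {a b} ha hb g hg => by rw [map_mul, ha g hg, hb g hg]
  algebraMap_mem' := fun r g hg => (polyAct g).commutes r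

/-- Action of `g` on a differential 1-form `ω = ∑ i (w i) dz_i`; the result is the
coefficient vector of `g · ω`. -/
noncomputable def oneFormAct (g : GLn F n) (w : Fin n → MvPolynomial (Fin n) F) :
    Fin n → MvPolynomial (Fin n) F :=
  fun j => ∑ i, polyAct g (w i) * C (actMat g i j)

/-- The coefficient of `dz_J` in `g · dz_I` (a minor determinant of `actMat g`). -/
noncomputable def minorDet (g : GLn F n) (I J : Finset (Fin n)) : F :=
  if h : J.card = I.card then
    Matrix.det (Matrix.of fun a b : Fin I.card =>
      actMat g (I.orderIsoOfFin rfl a) (J.orderIsoOfFin h b))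
  else 0

/-- Action of `g` on a differential form `μ = ∑_I u_I dz_I`, given by its coefficient
function `u : Finset (Fin n) → F[V]`. -/
noncomputable def formAct (g : GLn F n) (u : Finset (Fin n) → MvPolynomial (Fin n) F) :
    Finset (Fin n) → MvPolynomial (Fin n) F :=
  fun J => ∑ I : Finset (Fin n), polyAct g (u I) * C (minorDet g I J)

/-- The sign arising when wedging `dz_I ∧ dz_J` into `dz_(I ∪ J)` for disjoint `I`, `J`. -/
def wsign (I J : Finset (Fin n)) : ℤ :=
  (-1) ^ ((I ×ˢ J).filter fun p => p.2 < p.1).card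

/-- Wedge product of differential forms in terms of coefficient functions. -/
noncomputable def wedgeF (u v : Finset (Fin n) → MvPolynomial (Fin n) F) :
    Finset (Fin n) → MvPolynomial (Fin n) F :=
  fun K => ∑ I ∈ K.powerset, wsign I (K \ I) • (u I * v (K \ I))

/-- The constant 0-form `1`. -/
noncomputable def unitForm : Finset (Fin n) → MvPolynomial (Fin n) F :=
  fun S => if S = ∅ then 1 else 0

/-- Iterated wedge product of a list of forms. -/
noncomputable def iterWedge (L : List (Finset (Fin n) → MvPolynomial (Fin n) F)) :
    Finset (Fin n) → MvPolynomial (Fin n) F :=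
  L.foldr wedgeF unitForm

/-- A 1-form, viewed as a differential form via its coefficient function. -/
noncomputable def oneToForm (w : Fin n → MvPolynomial (Fin n) F) :
    Finset (Fin n) → MvPolynomial (Fin n) F :=
  fun S => if h : S.card = 1 then w (S.min' (Finset.card_pos.mp (by omega))) else 0

/-- The fixed space of `g` in `V`. -/
noncomputable def fixedSpace (g : GLn F n) : Submodule F (Fin n → F) :=
  LinearMap.ker (g.toLinearMap - LinearMap.id)

/-- A reflection: an element of finite order whose fixed space is a hyperplane. -/
def IsReflection (g : GLn F n) : Prop :=
  IsOfFinOrder g ∧ Module.finrank F (fixedSpace g) = n - 1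

/-- A transvection: a (necessarily nondiagonalizable) reflection of determinant one. -/
def IsTransvection (g : GLn F n) : Prop :=
  IsReflection g ∧ LinearMap.det g.toLinearMap = 1 ∧ g ≠ 1

/-- The pointwise stabilizer `G_H` of a subspace `H` in `G`. -/
def pointStab (G : Subgroup (GLn F n)) (H : Submodule F (Fin n → F)) : Subgroup (GLn F n) where
  carrier := {g | g ∈ G ∧ ∀ v ∈ H, g v = v}
  one_mem' := ⟨G.one_mem, fun v _ => rfl⟩
  mul_mem' := fun {a b} ha hb => ⟨G.mul_mem ha.1 hb.1, fun v hv => by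
    show a (b v) = v
    rw [hb.2 v hv, ha.2 v hv]⟩
  inv_mem' := fun {a} ha => ⟨G.inv_mem ha.1, fun v hv => by
    show a.symm v = v
    conv_lhs => rw [← ha.2 v hv]
    exact a.symm_apply_apply v⟩

/-- `K_H`: the subgroup of `G_H` of elements of determinant one
(the transvections in `G_H` together with the identity). -/
noncomputable def KH (G : Subgroup (GLn F n)) (H : Submodule F (Fin n → F)) :
    Subgroup (GLn F n) :=
  pointStab G H ⊓ MonoidHom.ker LinearEquiv.det

/-- `e_H = |G_H : K_H|`. -/
noncomputable def eH (G : Subgroup (GLn F n)) (H : Submodule F (Fin n → F)) : ℕ :=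
  ((KH G H).subgroupOf (pointStab G H)).index

/-- The transvection root space of `G_H`: the span of the root vectors of the
transvections in `G_H` (the root vector of `t` spans the range of `t - 1`). -/
noncomputable def trvSpace (G : Subgroup (GLn F n)) (H : Submodule F (Fin n → F)) :
    Submodule F (Fin n → F) :=
  ⨆ g ∈ {g : GLn F n | g ∈ pointStab G H ∧ IsTransvection g},
    LinearMap.range (g.toLinearMap - LinearMap.id)

/-- `b_H`: the dimension of the transvection root space of `G_H`. -/
noncomputable def bH (G : Subgroup (GLn F n)) (H : Submodule F (Fin n → F)) : ℕ :=
  Module.finrank F (trvSpace G H)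

/-- The basic invariants `f_k^H = z_k^q - z_k z_n^{q-1}` (for `k < n`) and
`f_n^H = z_n^{q-1}` of the pointwise stabilizer of the hyperplane `H = ker zₙ`. -/
noncomputable def stabBasic (F : Type*) [Field F] [Fintype F] (n : ℕ) (k : Fin (n + 1)) :
    MvPolynomial (Fin (n + 1)) F :=
  if k = Fin.last n then X (Fin.last n) ^ (Fintype.card F - 1)
  else X k ^ Fintype.card F - X k * X (Fin.last n) ^ (Fintype.card F - 1)

/-- Evaluated at roots of monic polynomials `P i`, every polynomial agrees with one whose degree
in each variable `i` is smaller than that of `P i`. -/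
theorem exists_degreeOf_lt_aeval_eq {σ A B : Type*} [CommRing A] [CommRing B]
    [Algebra A B] (x : σ → B) (P : σ → Polynomial A) (hmonic : ∀ i, (P i).Monic)
    (hroot : ∀ i, Polynomial.aeval (x i) (P i) = 0) (hpos : ∀ i, 0 < (P i).natDegree)
    (p : MvPolynomial σ A) :
    ∃ Q : MvPolynomial σ A, (∀ i, Q.degreeOf i < (P i).natDegree) ∧ aeval x Q = aeval x p := by
  classical
  induction p using MvPolynomial.induction_on' with
  | add p q hp hq =>
    obtain ⟨Q, hQ, hQp⟩ := hp
    obtain ⟨R, hR, hRq⟩ := hq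
    exact ⟨Q + R, fun i => (degreeOf_add_le i Q R).trans_lt (max_lt (hQ i) (hR i)), by
      rw [map_add, map_add, hQp, hRq]⟩
  | monomial u a =>
    let r : σ → Polynomial A := fun i => (Polynomial.X ^ u i) %ₘ P i
    have hr : ∀ i, (r i).natDegree < (P i).natDegree := fun i =>
      Polynomial.natDegree_modByMonic_lt _ (hmonic i) fun h => by
        have := hpos i
        simp [h] at this
    have hr_eval : ∀ i, Polynomial.aeval (x i) (r i) = x i ^ u i := fun i => by
      have h := congrArg (Polynomial.aeval (x i))
        (Polynomial.modByMonic_add_div (Polynomial.X ^ u i) (P i))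
      simpa [hroot i] using h
    have hdeg_self : ∀ i, ((r i).toMvPolynomial i).degreeOf i ≤ (r i).natDegree := fun i => by
      rw [Polynomial.toMvPolynomial, Polynomial.aeval_eq_sum_range]
      refine (degreeOf_sum_le i _ _).trans (Finset.sup_le fun k hk => ?_)
      rw [smul_eq_C_mul]
      refine (degreeOf_C_mul_le _ _ _).trans ((degreeOf_pow_le _ _ _).trans ?_)
      have h : degreeOf i (X i : MvPolynomial σ A) ≤ 1 := by
        rcases subsingleton_or_nontrivial A with _ | _
        · simp [Subsingleton.elim (X i : MvPolynomial σ A) 0]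
        · simp
      have hk := Finset.mem_range_succ_iff.mp hk
      nlinarith
    have hdeg_ne : ∀ i j, i ≠ j → ((r j).toMvPolynomial j).degreeOf i = 0 := fun i j hij => by
      rw [Polynomial.toMvPolynomial, Polynomial.aeval_eq_sum_range, ← Nat.le_zero]
      refine (degreeOf_sum_le i _ _).trans (Finset.sup_le fun k _ => ?_)
      rw [smul_eq_C_mul]
      refine (degreeOf_C_mul_le _ _ _).trans ((degreeOf_pow_le _ _ _).trans ?_)
      simp [degreeOf_X_of_ne hij]
    refine ⟨C a * ∏ j ∈ u.support, (r j).toMvPolynomial j, fun i => ?_, ?_⟩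
    · refine (degreeOf_C_mul_le _ _ _).trans_lt ((degreeOf_prod_le _ _ _).trans_lt ?_)
      by_cases hi : i ∈ u.support
      · rw [Finset.sum_eq_single_of_mem i hi fun j _ hj => hdeg_ne i j hj.symm]
        exact (hdeg_self i).trans_lt (hr i)
      · rw [Finset.sum_eq_zero fun j hj => hdeg_ne i j fun h => hi (h ▸ hj)]
        exact hpos i
    · have h : ∀ j, aeval x ((r j).toMvPolynomial j) = x j ^ u j := fun j => by
        rw [← hr_eval j, Polynomial.toMvPolynomial, ← Polynomial.aeval_algHom_apply, aeval_X]
      simp [aeval_monomial, h, Finsupp.prod]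

/-- A polynomial whose degrees are smaller than the sizes of a grid on which it takes a constant
value is constant. -/
theorem eq_C_of_eval_eq_on_grid {σ R : Type*} [Finite σ] [CommRing R] [IsDomain R]
    (Q : MvPolynomial σ R) (S : σ → Finset R) (hdeg : ∀ i, Q.degreeOf i < (S i).card) (b : R)
    (h : ∀ x : σ → R, (∀ i, x i ∈ S i) → eval x Q = b) : Q = C b := by
  refine sub_eq_zero.mp (eq_zero_of_eval_zero_at_prod_finset _ S (fun i => ?_) fun x hx => ?_)
  · refine (degreeOf_sub_le i Q (C b)).trans_lt ?_
    rw [degreeOf_C, max_lt_iff]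
    exact ⟨hdeg i, (Nat.zero_le _).trans_lt (hdeg i)⟩
  · rw [map_sub, h x hx, eval_C, sub_self]

/-- The endomorphism fixing the hyperplane where the last coordinate vanishes and sending the last
basis vector to `e`. -/
def hyperplaneFixingMap {F : Type*} [Field F] {n : ℕ} (e : Fin (n + 1) → F) :
    (Fin (n + 1) → F) →ₗ[F] (Fin (n + 1) → F) where
  toFun v k := (if k = Fin.last n then 0 else v k) + e k * v (Fin.last n)
  map_add' v w := by
    ext k
    simp only [Pi.add_apply]
    split_ifs <;> ring
  map_smul' c v := by
    ext k
    simp only [Pi.smul_apply, smul_eq_mul, RingHom.id_apply]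
    split_ifs <;> ring

theorem hyperplaneFixingMap_injective {F : Type*} [Field F] {n : ℕ} {e : Fin (n + 1) → F}
    (he : e (Fin.last n) ≠ 0) : Function.Injective (hyperplaneFixingMap e) := by
  rw [injective_iff_map_eq_zero]
  intro v hv
  have hlast : v (Fin.last n) = 0 := by
    simpa [hyperplaneFixingMap, he] using congrFun hv (Fin.last n)
  ext k
  by_cases hk : k = Fin.last n
  · simp [hk, hlast]
  · simpa [hyperplaneFixingMap, hk, hlast] using congrFun hv k

/-- The inverse of `hyperplaneFixingMap e`, as a linear automorphism. -/
noncomputable def hyperplaneFixingEquiv {F : Type*} [Field F] {n : ℕ} (e : Fin (n + 1) → F)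
    (he : e (Fin.last n) ≠ 0) : GLn F (n + 1) :=
  (LinearEquiv.ofInjectiveEndo _ (hyperplaneFixingMap_injective he)).symm

theorem hyperplaneFixingEquiv_apply_of_last_eq_zero {F : Type*} [Field F] {n : ℕ}
    (e : Fin (n + 1) → F) (he : e (Fin.last n) ≠ 0) (v : Fin (n + 1) → F)
    (hv : v (Fin.last n) = 0) : hyperplaneFixingEquiv e he v = v := by
  rw [hyperplaneFixingEquiv, LinearEquiv.symm_apply_eq, LinearEquiv.coe_ofInjectiveEndo]
  ext k
  by_cases hk : k = Fin.last n <;> simp [hyperplaneFixingMap, hk, hv]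

/-- An automorphism fixing the hyperplane pointwise changes each coordinate function by a
multiple of the last one. -/
theorem polyAct_X_of_fixes {F : Type*} [Field F] {n : ℕ} (g : GLn F (n + 1))
    (hg : ∀ v : Fin (n + 1) → F, v (Fin.last n) = 0 → g v = v) (k : Fin (n + 1)) :
    polyAct g (X k) = (if k = Fin.last n then 0 else X k) +
      C (actMat g k (Fin.last n)) * X (Fin.last n) := by
  have hcol : ∀ j, j ≠ Fin.last n → actMat g k j = Pi.single (M := fun _ => F) j 1 k := by
    intro j hj
    have h : g.symm (Pi.single j 1) = Pi.single j 1 := by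
      rw [LinearEquiv.symm_apply_eq, hg]
      simp [hj.symm]
    rw [actMat, Matrix.of_apply, h]
  rw [polyAct, aeval_X, Fin.sum_univ_castSucc]
  congr 1
  rw [Finset.sum_congr rfl fun j _ => by rw [hcol _ (Fin.castSucc_ne_last j)]]
  refine Fin.lastCases ?_ (fun i => ?_) k
  · simp [(Fin.castSucc_ne_last _).symm]
  · simp [Pi.single_apply, Fin.castSucc_ne_last, Fin.castSucc_inj]

theorem actMat_last_last_ne_zero {F : Type*} [Field F] {n : ℕ} (g : GLn F (n + 1))
    (hg : ∀ v : Fin (n + 1) → F, v (Fin.last n) = 0 → g v = v) :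
    actMat g (Fin.last n) (Fin.last n) ≠ 0 := by
  intro h
  have h1 : g.symm (Pi.single (Fin.last n) 1) = Pi.single (Fin.last n) 1 := by
    rw [← hg (g.symm (Pi.single (Fin.last n) 1)) h, g.apply_symm_apply]
  simp [actMat, h1] at h

theorem polyAct_hyperplaneFixingEquiv_X {F : Type*} [Field F] {n : ℕ} (e : Fin (n + 1) → F)
    (he : e (Fin.last n) ≠ 0) (k : Fin (n + 1)) :
    polyAct (hyperplaneFixingEquiv e he) (X k) =
      (if k = Fin.last n then 0 else X k) + C (e k) * X (Fin.last n) := by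
  rw [polyAct_X_of_fixes _ (hyperplaneFixingEquiv_apply_of_last_eq_zero e he)]
  congr 3
  rw [actMat, hyperplaneFixingEquiv, LinearEquiv.symm_symm, Matrix.of_apply,
    LinearEquiv.coe_ofInjectiveEndo]
  by_cases hk : k = Fin.last n <;> simp [hyperplaneFixingMap, hk]

theorem polyAct_stabBasic {F : Type*} [Field F] [Fintype F] {n : ℕ} (g : GLn F (n + 1))
    (hg : ∀ v : Fin (n + 1) → F, v (Fin.last n) = 0 → g v = v) (k : Fin (n + 1)) :
    polyAct g (stabBasic F n k) = stabBasic F n k := by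
  have ha := actMat_last_last_ne_zero g hg
  have hX := polyAct_X_of_fixes g hg
  have hlast : polyAct g (X (Fin.last n) ^ (Fintype.card F - 1)) =
      X (Fin.last n) ^ (Fintype.card F - 1) := by
    rw [map_pow, hX, if_pos rfl, zero_add, mul_pow, ← C_pow,
      FiniteField.pow_card_sub_one_eq_one _ ha, C_1, one_mul]
  by_cases hk : k = Fin.last n
  · simp only [stabBasic, if_pos hk, hlast]
  · simp only [stabBasic, if_neg hk]
    rw [map_sub, map_mul, map_pow, hlast, hX, if_neg hk]
    obtain ⟨p, hp⟩ := CharP.exists F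
    obtain ⟨m, hprime, hcard⟩ := FiniteField.card F p
    have := Fact.mk hprime
    have hfrob : ∀ a b : MvPolynomial (Fin (n + 1)) F,
        (a + b) ^ Fintype.card F = a ^ Fintype.card F + b ^ Fintype.card F := by
      intro a b
      rw [hcard]
      exact add_pow_char_pow a b p m
    have hsucc : (X (Fin.last n) : MvPolynomial (Fin (n + 1)) F) ^ Fintype.card F =
        X (Fin.last n) * X (Fin.last n) ^ (Fintype.card F - 1) := by
      rw [← pow_succ', Nat.sub_add_cancel Fintype.card_pos]
    rw [hfrob, mul_pow, ← C_pow, FiniteField.pow_card, hsucc]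
    ring

section

variable (F : Type*) [Field F] [Fintype F] (n : ℕ)

/-- `stabBasic F n k` as an element of the subalgebra generated by all of them. -/
noncomputable def stabBasicAdjoin (k : Fin (n + 1)) :
    Algebra.adjoin F (Set.range (stabBasic F n)) :=
  ⟨stabBasic F n k, Algebra.subset_adjoin (Set.mem_range_self k)⟩

/-- The equation satisfied by the `k`-th coordinate function over the subalgebra generated by the
basic invariants. -/
noncomputable def coordPoly (k : Fin (n + 1)) :
    Polynomial (Algebra.adjoin F (Set.range (stabBasic F n))) :=
  if k = Fin.last n then
    Polynomial.X ^ (Fintype.card F - 1) - Polynomial.C (stabBasicAdjoin F n (Fin.last n))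
  else
    Polynomial.X ^ Fintype.card F -
      (Polynomial.C (stabBasicAdjoin F n (Fin.last n)) * Polynomial.X +
        Polynomial.C (stabBasicAdjoin F n k))

theorem coordPoly_monic (k : Fin (n + 1)) : (coordPoly F n k).Monic := by
  have h1 : 1 < Fintype.card F := Fintype.one_lt_card
  unfold coordPoly
  split_ifs
  · exact Polynomial.monic_X_pow_sub_C _ (by omega)
  · refine (Polynomial.monic_X_pow _).sub_of_left ?_
    rw [Polynomial.degree_X_pow]
    exact Polynomial.degree_linear_le.trans_lt (by exact_mod_cast h1)

theorem natDegree_coordPoly (k : Fin (n + 1)) :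
    (coordPoly F n k).natDegree =
      if k = Fin.last n then Fintype.card F - 1 else Fintype.card F := by
  unfold coordPoly
  split_ifs
  · exact Polynomial.natDegree_X_pow_sub_C
  · rw [Polynomial.natDegree_sub_eq_left_of_natDegree_lt, Polynomial.natDegree_X_pow]
    rw [Polynomial.natDegree_X_pow]
    exact Polynomial.natDegree_linear_le.trans_lt Fintype.one_lt_card

theorem aeval_coordPoly (k : Fin (n + 1)) :
    Polynomial.aeval (X k : MvPolynomial (Fin (n + 1)) F) (coordPoly F n k) = 0 := by
  have hval : ∀ j, algebraMap (Algebra.adjoin F (Set.range (stabBasic F n)))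
      (MvPolynomial (Fin (n + 1)) F) (stabBasicAdjoin F n j) = stabBasic F n j := fun _ => rfl
  rw [Polynomial.aeval_def]
  unfold coordPoly
  split_ifs with hk
  · rw [Polynomial.eval₂_sub, Polynomial.eval₂_pow, Polynomial.eval₂_X, Polynomial.eval₂_C, hval,
      stabBasic, if_pos rfl, hk, sub_self]
  · rw [Polynomial.eval₂_sub, Polynomial.eval₂_add, Polynomial.eval₂_mul, Polynomial.eval₂_pow,
      Polynomial.eval₂_X, Polynomial.eval₂_C, Polynomial.eval₂_C, hval, hval, stabBasic, stabBasic,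
      if_pos rfl, if_neg hk]
    ring

theorem algebraicIndependent_stabBasic : AlgebraicIndependent F (stabBasic F n) := by
  let A := Algebra.adjoin F (Set.range (stabBasic F n))
  have hX : ∀ k, (X k : MvPolynomial (Fin (n + 1)) F) ∈
      (integralClosure A (MvPolynomial (Fin (n + 1)) F)) := fun k =>
    ⟨coordPoly F n k, coordPoly_monic F n k, aeval_coordPoly F n k⟩
  have htop : ∀ p : MvPolynomial (Fin (n + 1)) F,
      p ∈ (integralClosure A (MvPolynomial (Fin (n + 1)) F)) := by
    intro p
    induction p using MvPolynomial.induction_on with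
    | C a =>
      exact Subalgebra.algebraMap_mem _ (algebraMap F A a)
    | add p q hp hq => exact add_mem hp hq
    | mul_X p k hp => exact mul_mem hp (hX k)
  have : Algebra.IsIntegral A (MvPolynomial (Fin (n + 1)) F) := ⟨htop⟩
  have : Algebra.IsAlgebraic A (MvPolynomial (Fin (n + 1)) F) := Algebra.IsIntegral.isAlgebraic
  refine (Algebra.IsAlgebraic.isTranscendenceBasis_of_lift_le_trdeg_of_finite F (stabBasic F n) ?_).1
  rw [MvPolynomial.trdeg_of_isDomain]
  simp

theorem mem_adjoin_of_invariant (p : MvPolynomial (Fin (n + 1)) F)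
    (hp : ∀ g : GLn F (n + 1),
      (∀ v : Fin (n + 1) → F, v (Fin.last n) = 0 → g v = v) → polyAct g p = p) :
    p ∈ Algebra.adjoin F (Set.range (stabBasic F n)) := by
  classical
  set A := Algebra.adjoin F (Set.range (stabBasic F n))
  have hcard : 1 < Fintype.card F := Fintype.one_lt_card
  obtain ⟨Q, hdeg, hQ⟩ := exists_degreeOf_lt_aeval_eq
    (X : Fin (n + 1) → MvPolynomial (Fin (n + 1)) F) (coordPoly F n) (coordPoly_monic F n)
    (aeval_coordPoly F n) (fun i => by rw [natDegree_coordPoly]; split_ifs <;> omega)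
    (map (algebraMap F A) p)
  rw [aeval_map_algebraMap, aeval_X_left_apply] at hQ
  have hA : ∀ g : GLn F (n + 1), (∀ v : Fin (n + 1) → F, v (Fin.last n) = 0 → g v = v) →
      ∀ a ∈ A, polyAct g a = a := by
    intro g hg a ha
    have : A ≤ AlgHom.equalizer (polyAct g) (AlgHom.id F _) :=
      Algebra.adjoin_le (by rintro _ ⟨k, rfl⟩; exact polyAct_stabBasic g hg k)
    exact this ha
  have hcomp : ∀ g : GLn F (n + 1), (∀ v : Fin (n + 1) → F, v (Fin.last n) = 0 → g v = v) →
      eval (fun k => polyAct g (X k)) (map (algebraMap A _) Q) = p := by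
    intro g hg
    conv_rhs => rw [← hp g hg, ← hQ]
    rw [eval_map, aeval_def, ← AlgHom.coe_toRingHom, hom_eval₂]
    congr 1
    ext a : 1
    exact (hA g hg a a.2).symm
  let T : Fin (n + 1) → Finset F := fun k => if k = Fin.last n then {0}ᶜ else Finset.univ
  let φ : Fin (n + 1) → F → MvPolynomial (Fin (n + 1)) F := fun k c =>
    (if k = Fin.last n then 0 else X k) + C c * X (Fin.last n)
  have hφ : ∀ k, Function.Injective (φ k) := fun k c d h =>
    C_injective _ _ (mul_right_cancel₀ (X_ne_zero _) (add_left_cancel h))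
  have hconst : map (algebraMap A (MvPolynomial (Fin (n + 1)) F)) Q = C p := by
    refine eq_C_of_eval_eq_on_grid _ (fun k => (T k).image (φ k)) (fun k => ?_) p fun x hx => ?_
    · rw [Finset.card_image_of_injective _ (hφ k)]
      refine lt_of_le_of_lt ?_ ((hdeg k).trans_eq ?_)
      · rw [degreeOf_def, degrees_map_of_injective _ Subtype.val_injective, ← degreeOf_def]
      · rw [natDegree_coordPoly]
        simp only [T]
        split_ifs <;> simp [Finset.card_compl]
    · choose e he hex using fun k => Finset.mem_image.mp (hx k)
      have hlast : e (Fin.last n) ≠ 0 := by simpa [T] using he (Fin.last n)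
      rw [← hcomp _ (hyperplaneFixingEquiv_apply_of_last_eq_zero e hlast)]
      congr 2
      ext1 k
      rw [← hex, polyAct_hyperplaneFixingEquiv_X]
  have hcoeff := congrArg (coeff 0) hconst
  rw [coeff_map, coeff_zero_C] at hcoeff
  rw [← hcoeff]
  exact (coeff 0 Q).2

end

/-- the polynomials `f_k^H` are algebraically independent, invariant
under the pointwise stabilizer `GL(V)_H` of `H = ker zₙ`, and generate its invariant
ring. -/
theorem stmt15 {F : Type*} [Field F] [Fintype F] {n : ℕ}
    (G : Subgroup (GLn F (n + 1)))
    (hG : ∀ g : GLn F (n + 1), g ∈ G ↔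
      ∀ v : Fin (n + 1) → F, v (Fin.last n) = 0 → g v = v) :
    AlgebraicIndependent F (stabBasic F n) ∧
    (∀ k, stabBasic F n k ∈ invSub G) ∧
    Algebra.adjoin F (Set.range (stabBasic F n)) = invSub G := by
  refine ⟨algebraicIndependent_stabBasic F n,
    fun k g hg => polyAct_stabBasic g ((hG g).mp hg) k, le_antisymm ?_ fun p hp => ?_⟩
  · refine Algebra.adjoin_le ?_
    rintro _ ⟨k, rfl⟩ g hg
    exact polyAct_stabBasic g ((hG g).mp hg) k
  · exact mem_adjoin_of_invariant F n p fun g hg => hp g ((hG g).mpr hg)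
end

section
/- Let G ≤ GL_n(F) be a finite reflection group and χ a linear character of G. If ω₁,...,ωₙ are χ-invariant 1-forms (g·ωᵢ = χ(g)ωᵢ for all g ∈ G), then Q(Ã_χ)·Q_χ^{n−1}·Q_{χ·det} divides the polynomial f with ω₁∧...∧ωₙ = f·vol. -/
open MvPolynomial

variable {F : Type*} [Field F] {n : ℕ}

lemma apply_eq_sum_smul_single {M : Type*} [AddCommMonoid M] [Module F M]
    (f : (Fin n → F) →ₗ[F] M) (v : Fin n → F) : f v = ∑ j, v j • f (Pi.single j 1) := by
  rw [LinearMap.pi_apply_eq_sum_univ f v]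
  refine Finset.sum_congr rfl fun j _ => ?_
  congr 2
  ext k
  simp [Pi.single_apply, eq_comm]

lemma linToPoly_smul (c : F) (z : (Fin n → F) →ₗ[F] F) :
    linToPoly (c • z) = C c * linToPoly z := by
  simp [linToPoly, Finset.mul_sum, mul_assoc]

lemma eval_linToPoly (z : (Fin n → F) →ₗ[F] F) (v : Fin n → F) :
    eval v (linToPoly z) = z v := by
  rw [apply_eq_sum_smul_single z v]
  simp [linToPoly, mul_comm]

lemma coeff_single_linToPoly (z : (Fin n → F) →ₗ[F] F) (i : Fin n) :
    coeff (Finsupp.single i 1) (linToPoly z) = z (Pi.single i 1) := by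
  simp [linToPoly, coeff_sum, coeff_C_mul, coeff_X, Finsupp.single_left_inj]

lemma exists_apply_single_ne_zero {z : (Fin n → F) →ₗ[F] F} (hz : z ≠ 0) :
    ∃ i, z (Pi.single i 1) ≠ 0 := by
  by_contra! h
  exact hz (LinearMap.pi_ext' fun i => LinearMap.ext_ring (by simpa using h i))

lemma linToPoly_ne_zero {z : (Fin n → F) →ₗ[F] F} (hz : z ≠ 0) : linToPoly z ≠ 0 := by
  obtain ⟨i, hi⟩ := exists_apply_single_ne_zero hz
  rintro h
  rw [← coeff_single_linToPoly, h, coeff_zero] at hi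
  exact hi rfl

lemma irreducible_linToPoly {z : (Fin n → F) →ₗ[F] F} (hz : z ≠ 0) :
    Irreducible (linToPoly z) := by
  obtain ⟨i, hi⟩ := exists_apply_single_ne_zero hz
  have hhom : (linToPoly z).IsHomogeneous 1 := by
    refine IsHomogeneous.sum _ _ _ fun j _ => ?_
    simpa using (isHomogeneous_C _ _).mul (isHomogeneous_X F j)
  refine irreducible_of_totalDegree_eq_one (hhom.totalDegree (linToPoly_ne_zero hz)) ?_
  intro x hx
  refine isUnit_iff_ne_zero.mpr ?_
  rintro rfl
  have := hx (Finsupp.single i 1)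
  rw [coeff_single_linToPoly, zero_dvd_iff] at this
  exact hi this

lemma isRelPrime_linToPoly {z z' : (Fin n → F) →ₗ[F] F} (hz : z ≠ 0) (hz' : z' ≠ 0)
    (h : LinearMap.ker z ≠ LinearMap.ker z') : IsRelPrime (linToPoly z) (linToPoly z') := by
  have key : ∀ {y y' : (Fin n → F) →ₗ[F] F}, linToPoly y ∣ linToPoly y' →
      LinearMap.ker y ≤ LinearMap.ker y' := by
    rintro y y' ⟨q, hq⟩ v hv
    rw [LinearMap.mem_ker] at hv ⊢
    rw [← eval_linToPoly y' v, hq, map_mul, eval_linToPoly, hv, zero_mul]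
  refine (irreducible_linToPoly hz).isRelPrime_iff_not_dvd.mpr fun hd => h ?_
  have hd' := ((irreducible_linToPoly hz).associated_of_dvd (irreducible_linToPoly hz') hd).symm.dvd
  exact le_antisymm (key hd) (key hd')

lemma polyAct_linToPoly (g : GLn F n) (z : (Fin n → F) →ₗ[F] F) :
    polyAct g (linToPoly z) = linToPoly (z ∘ₗ g.symm.toLinearMap) := by
  have h : ∀ j, z (g.symm (Pi.single j 1)) =
      ∑ i, z (Pi.single i 1) * g.symm (Pi.single j 1) i := fun j => by
    conv_lhs => rw [← eval_linToPoly z]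
    simp [linToPoly]
  simp only [linToPoly, polyAct, map_sum, map_mul, algHom_C, aeval_X, LinearMap.comp_apply,
    LinearEquiv.coe_coe, h, algebraMap_eq, Finset.sum_mul, Finset.mul_sum, actMat, Matrix.of_apply]
  rw [Finset.sum_comm]
  simp only [mul_assoc]

/-- A linear map that fixes the kernel of a nonzero linear form `ℓ` pointwise is a transvection
or dilatation along `ℓ`. -/
lemma exists_eq_add_smul {ℓ : (Fin n → F) →ₗ[F] F} (hℓ : ℓ ≠ 0) (g : (Fin n → F) →ₗ[F] Fin n → F)
    (hg : ∀ v, ℓ v = 0 → g v = v) : ∃ x, ∀ v, g v = v + ℓ v • x := by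
  obtain ⟨y, hy⟩ : ∃ y, ℓ y = 1 := LinearMap.surjective hℓ 1
  refine ⟨g y - y, fun v => ?_⟩
  have := hg (v - ℓ v • y) (by simp [hy])
  rw [map_sub, map_smul, sub_eq_iff_eq_add] at this
  rw [this, smul_sub]
  abel

lemma det_eq_one_add {ℓ : (Fin n → F) →ₗ[F] F} {g : GLn F n} {x : Fin n → F}
    (hx : ∀ v, g v = v + ℓ v • x) : LinearMap.det g.toLinearMap = 1 + ℓ x := by
  rw [← LinearMap.transvection.det ℓ x]
  congr 1
  refine LinearMap.ext fun v => ?_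
  simp [hx, LinearMap.transvection.apply]

lemma apply_eq_det_mul {ℓ : (Fin n → F) →ₗ[F] F} (hℓ : ℓ ≠ 0) {g : GLn F n}
    (hg : ∀ v, ℓ v = 0 → g v = v) (v : Fin n → F) :
    ℓ (g v) = LinearMap.det g.toLinearMap * ℓ v := by
  obtain ⟨x, hx⟩ := exists_eq_add_smul hℓ g.toLinearMap hg
  rw [det_eq_one_add hx, ← LinearEquiv.coe_coe, hx, map_add, map_smul, smul_eq_mul]
  ring

lemma symm_apply_eq_self {ℓ : (Fin n → F) →ₗ[F] F} {g : GLn F n}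
    (hg : ∀ v, ℓ v = 0 → g v = v) (v : Fin n → F) (hv : ℓ v = 0) : g.symm v = v := by
  rw [LinearEquiv.symm_apply_eq, hg v hv]

lemma C_det_mul_polyAct_linToPoly {ℓ : (Fin n → F) →ₗ[F] F} (hℓ : ℓ ≠ 0) {g : GLn F n}
    (hg : ∀ v, ℓ v = 0 → g v = v) :
    C (LinearMap.det g.toLinearMap) * polyAct g (linToPoly ℓ) = linToPoly ℓ := by
  rw [polyAct_linToPoly, ← linToPoly_smul]
  congr 1
  refine LinearMap.ext fun v => ?_
  simp only [LinearMap.smul_apply, LinearMap.comp_apply, LinearEquiv.coe_coe, smul_eq_mul]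
  rw [← apply_eq_det_mul hℓ hg, LinearEquiv.apply_symm_apply]

/-- An element fixing `ker ℓ` pointwise acts trivially modulo `ℓ`. -/
lemma linToPoly_dvd_polyAct_sub {ℓ : (Fin n → F) →ₗ[F] F} (hℓ : ℓ ≠ 0) {g : GLn F n}
    (hg : ∀ v, ℓ v = 0 → g v = v) (f : MvPolynomial (Fin n) F) :
    linToPoly ℓ ∣ polyAct g f - f := by
  obtain ⟨x, hx⟩ := exists_eq_add_smul hℓ g.symm.toLinearMap (symm_apply_eq_self hg)
  induction f using MvPolynomial.induction_on with
  | C c => simp [polyAct]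
  | add p q hp hq =>
    rw [map_add, add_sub_add_comm]
    exact dvd_add hp hq
  | mul_X p i hp =>
    have hX : polyAct g (X i) - X i = linToPoly ℓ * C (x i) := by
      have h : ∀ j, actMat g i j = (Pi.single j 1 : Fin n → F) i + ℓ (Pi.single j 1) * x i :=
        fun j => by
          have := congrFun (hx (Pi.single j 1)) i
          simpa [actMat] using this
      simp only [polyAct, aeval_X, h, map_add, map_mul, add_mul, Finset.sum_add_distrib, linToPoly,
        Finset.sum_mul]
      have h' : ∑ j, C ((Pi.single j 1 : Fin n → F) i) * X j = (X i : MvPolynomial (Fin n) F) := by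
        rw [Finset.sum_eq_single i] <;> simp +contextual [eq_comm]
      rw [h', add_sub_cancel_left]
      exact Finset.sum_congr rfl fun j _ => by ring
    have : polyAct g (p * X i) - p * X i =
        (polyAct g p - p) * polyAct g (X i) + p * (polyAct g (X i) - X i) := by
      rw [map_mul]; ring
    rw [this, hX]
    exact dvd_add (hp.mul_right _) ((dvd_mul_right _ _).mul_left _)

/-- A semi-invariant of weight `c` is divisible by the `m`-th power of `ℓ` if `c` is none of
the weights of `1, ℓ, …, ℓ ^ (m - 1)`. -/
lemma linToPoly_pow_dvd_of_semiinvariant {ℓ : (Fin n → F) →ₗ[F] F} (hℓ : ℓ ≠ 0) {g : GLn F n}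
    (hg : ∀ v, ℓ v = 0 → g v = v) (m : ℕ) (c : F) (f : MvPolynomial (Fin n) F)
    (hf : polyAct g f = C c * f)
    (hc : ∀ k < m, c * LinearMap.det g.toLinearMap ^ k ≠ 1) : linToPoly ℓ ^ m ∣ f := by
  induction m generalizing c f with
  | zero => simp
  | succ m ih =>
    have h1 : linToPoly ℓ ∣ C (c - 1) * f := by
      have := linToPoly_dvd_polyAct_sub hℓ hg f
      rwa [hf, ← sub_one_mul, ← C_1, ← C_sub] at this
    have hc0 : c - 1 ≠ 0 := sub_ne_zero.mpr (by simpa using hc 0 m.succ_pos)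
    have h2 : linToPoly ℓ ∣ f := by
      have := h1.mul_left (C (c - 1)⁻¹)
      rwa [← mul_assoc, ← C_mul, inv_mul_cancel₀ hc0, C_1, one_mul] at this
    obtain ⟨q, rfl⟩ := h2
    rw [pow_succ']
    refine mul_dvd_mul_left _ (ih (c * LinearMap.det g.toLinearMap) q ?_ fun k hk => ?_)
    · refine mul_left_cancel₀ (linToPoly_ne_zero hℓ) ?_
      conv_lhs => rw [← C_det_mul_polyAct_linToPoly hℓ hg, mul_assoc, ← map_mul, hf]
      rw [C_mul]
      ring
    · have := hc (k + 1) (by omega)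
      rwa [pow_succ', ← mul_assoc] at this

/-- The contraction of a 1-form with a constant vector field. -/
noncomputable def contract (w : Fin n → MvPolynomial (Fin n) F) (u : Fin n → F) :
    MvPolynomial (Fin n) F :=
  ∑ i, w i * C (u i)

lemma contract_add (w : Fin n → MvPolynomial (Fin n) F) (u v : Fin n → F) :
    contract w (u + v) = contract w u + contract w v := by
  simp [contract, mul_add, Finset.sum_add_distrib]

lemma contract_smul (w : Fin n → MvPolynomial (Fin n) F) (c : F) (u : Fin n → F) :
    contract w (c • u) = C c * contract w u := by
  simp [contract, Finset.mul_sum, mul_left_comm]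

lemma polyAct_contract {g : GLn F n} {w : Fin n → MvPolynomial (Fin n) F} {c : F}
    (hw : oneFormAct g w = fun j => C c * w j) (u : Fin n → F) :
    polyAct g (contract w u) = C c * contract w (g u) := by
  have key : ∀ v : Fin n → F, polyAct g (contract w (g.symm v)) = C c * contract w v := fun v => by
    have hv : ∀ i, g.symm v i = ∑ j, actMat g i j * v j := fun i => by
      have := congrFun (apply_eq_sum_smul_single g.symm.toLinearMap v) i
      simpa [actMat, mul_comm] using this
    calc polyAct g (contract w (g.symm v))
        = ∑ i, ∑ j, polyAct g (w i) * C (actMat g i j) * C (v j) := by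
          simp only [contract, map_sum, map_mul, algHom_C, algebraMap_eq, hv, Finset.mul_sum,
            mul_assoc]
      _ = ∑ j, oneFormAct g w j * C (v j) := by
          rw [Finset.sum_comm]
          simp only [oneFormAct, Finset.sum_mul]
      _ = C c * contract w v := by
          simp only [hw, contract, Finset.mul_sum, mul_assoc]
  simpa using key (g u)

lemma prod_dvd_det {R : Type*} [CommRing R] {ι : Type*} [Fintype ι] [DecidableEq ι]
    (M : Matrix ι ι R) (p : ι → R) (h : ∀ i k, p k ∣ M i k) : ∏ k, p k ∣ M.det := by
  choose N hN using h
  refine ⟨(Matrix.of N).det, ?_⟩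
  rw [← Matrix.det_mul_row]
  congr 1
  ext i j
  simp [hN]

/-- If the contractions of the 1-forms `ω i` with a basis of constant vector fields are divisible
by given polynomials, then so is the determinant of their coefficients by the product. -/
lemma prod_dvd_det_of_basis {ι : Type*} [Fintype ι] (b : Module.Basis ι F (Fin n → F))
    (ω : Fin n → Fin n → MvPolynomial (Fin n) F) (p : ι → MvPolynomial (Fin n) F)
    (h : ∀ i k, p k ∣ contract (ω i) (b k)) :
    ∏ k, p k ∣ Matrix.det (Matrix.of fun i j => ω i j) := by
  classical
  let e : ι ≃ Fin n := b.indexEquiv (Pi.basisFun F (Fin n))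
  let B := b.reindex e
  have hu : IsUnit ((Pi.basisFun F (Fin n)).toMatrix B).det :=
    (Matrix.isUnit_iff_isUnit_det _).mp
      (IsUnit.of_mul_eq_one _ ((Pi.basisFun F (Fin n)).toMatrix_mul_toMatrix_flip B))
  have hd := prod_dvd_det (Matrix.of (fun i j => ω i j) *
    ((Pi.basisFun F (Fin n)).toMatrix B).map C) (fun k => p (e.symm k)) (fun i k => by
      have := h i (e.symm k)
      simpa [Matrix.mul_apply, Module.Basis.toMatrix_apply, contract, B] using this)
  rw [Matrix.det_mul, Equiv.prod_comp e.symm p] at hd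
  have hu' : IsUnit (((Pi.basisFun F (Fin n)).toMatrix B).map C :
      Matrix (Fin n) (Fin n) (MvPolynomial (Fin n) F)).det := by
    have := hu.map (C : F →+* MvPolynomial (Fin n) F)
    rwa [RingHom.map_det] at this
  exact hu'.dvd_mul_right.mp hd

lemma pow_dvd_det_of_subspace (ω : Fin n → Fin n → MvPolynomial (Fin n) F)
    (l : MvPolynomial (Fin n) F) (U : Submodule F (Fin n → F)) (r : Fin n → F) (hr : r ∉ U)
    (c d : ℕ) (hU : ∀ i, ∀ u ∈ U, l ^ c ∣ contract (ω i) u)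
    (hωr : ∀ i, l ^ d ∣ contract (ω i) r) :
    l ^ (c * Module.finrank F U + d) ∣ Matrix.det (Matrix.of fun i j => ω i j) := by
  classical
  let bU := Module.finBasis F U
  have hli : LinearIndependent F fun k => (bU k : Fin n → F) :=
    bU.linearIndependent.map' U.subtype U.ker_subtype
  have hspan : Submodule.span F (Set.range fun k => (bU k : Fin n → F)) ≤ U := by
    rw [Submodule.span_le]
    rintro _ ⟨k, rfl⟩
    exact (bU k).2
  have hopt := hli.option (x := r) fun h => hr (hspan h)
  let B := Module.Basis.sumExtend hopt
  have : Finite (Option (Fin (Module.finrank F U)) ⊕ Module.Basis.sumExtendIndex hopt) :=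
    Module.Finite.finite_basis B
  have : Finite (Module.Basis.sumExtendIndex hopt) :=
    Finite.of_injective (β := Option (Fin (Module.finrank F U)) ⊕ Module.Basis.sumExtendIndex hopt)
      Sum.inr Sum.inr_injective
  have := Fintype.ofFinite (Module.Basis.sumExtendIndex hopt)
  have hB : ∀ o, B (Sum.inl o) = Option.casesOn' o r fun k => (bU k : Fin n → F) := fun o => by
    simp [B, Module.Basis.sumExtend]
    rfl
  have := prod_dvd_det_of_basis B ω
    (Sum.elim (fun o => Option.casesOn' o (l ^ d) fun _ => l ^ c) fun _ => 1) (by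
      rintro i ((_ | k) | _)
      · simpa [hB] using hωr i
      · simpa [hB] using hU i _ (bU k).2
      · simp)
  simpa [Fintype.prod_sum_type, Fintype.prod_option, ← pow_mul, ← pow_add, add_comm] using this

/-- A linear character with values in a field is trivial on transvections. -/
lemma map_eq_one_of_isTransvection {G : Subgroup (GLn F n)} (χ : G →* Fˣ) {ℓ : (Fin n → F) →ₗ[F] F}
    (hℓ : ℓ ≠ 0) {t : G} (ht : ∀ v, ℓ v = 0 → (t : GLn F n) v = v)
    (htr : IsTransvection (t : GLn F n)) : χ t = 1 := by
  obtain ⟨⟨hfin, -⟩, hdet, hne⟩ := htr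
  obtain ⟨x, hx⟩ := exists_eq_add_smul hℓ (t : GLn F n).toLinearMap ht
  simp only [LinearEquiv.coe_coe] at hx
  rw [det_eq_one_add hx, add_eq_left] at hdet
  have hpow : ∀ (k : ℕ) v, ((t : GLn F n) ^ k) v = v + (k : F) • ℓ v • x := fun k => by
    induction k with
    | zero => simp
    | succ k ih =>
      intro v
      rw [pow_succ, LinearEquiv.mul_apply, ih, hx]
      simp only [map_add, map_smul, hdet, smul_eq_mul, mul_zero, add_zero, Nat.cast_succ, add_smul,
        one_smul]
      abel
  obtain ⟨y, hy⟩ : ∃ y, ℓ y = 1 := LinearMap.surjective hℓ 1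
  have hx0 : x ≠ 0 := by
    rintro rfl
    exact hne (LinearEquiv.ext fun v => by simp [hx])
  obtain ⟨N, hN, hN1⟩ := hfin.exists_pow_eq_one
  have hNF : (N : F) = 0 := by
    have := hpow N y
    rw [hN1] at this
    simpa [hy, hx0] using this
  obtain ⟨p, hp⟩ := CharP.exists F
  have hp0 : p ≠ 0 := by
    rintro rfl
    rw [CharP.cast_eq_zero_iff F 0 N] at hNF
    exact hN.ne' (zero_dvd_iff.mp hNF)
  have : Fact p.Prime := ⟨(CharP.char_is_prime_or_zero F p).resolve_right hp0⟩
  have htp : t ^ p = 1 := by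
    ext1
    refine LinearEquiv.ext fun v => ?_
    simp [hpow]
  have hχ : (χ t : F) ^ p = 1 := by
    rw [← Units.val_pow_eq_pow_val, ← map_pow, htp, map_one, Units.val_one]
  have : ((χ t : F) - 1) ^ p = 0 := by rw [sub_pow_char, hχ, one_pow, sub_self]
  exact Units.ext (by simpa [sub_eq_zero] using eq_zero_of_pow_eq_zero this)

/-- An element fixing `ker ℓ` pointwise whose determinant is nontrivial unless it is the identity
has an eigenvector outside `ker ℓ`, with eigenvalue the determinant. -/
lemma exists_eigenvector {ℓ : (Fin n → F) →ₗ[F] F} (hℓ : ℓ ≠ 0) {s : GLn F n}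
    (hs : ∀ v, ℓ v = 0 → s v = v) (hdet : LinearMap.det s.toLinearMap = 1 → s = 1) :
    ∃ r, ℓ r ≠ 0 ∧ s r = LinearMap.det s.toLinearMap • r := by
  by_cases h : LinearMap.det s.toLinearMap = 1
  · obtain ⟨y, hy⟩ : ∃ y, ℓ y = 1 := LinearMap.surjective hℓ 1
    exact ⟨y, by simp [hy], by rw [h, hdet h]; simp⟩
  · obtain ⟨x, hx⟩ := exists_eq_add_smul hℓ s.toLinearMap hs
    simp only [LinearEquiv.coe_coe] at hx
    rw [det_eq_one_add hx] at h ⊢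
    exact ⟨x, by simpa using h, by rw [hx, add_smul, one_smul]⟩

/-- The contraction of a `χ`-invariant 1-form with the root vector of a transvection. -/
lemma pow_dvd_contract_of_isTransvection {G : Subgroup (GLn F n)} (χ : G →* Fˣ)
    {ℓ : (Fin n → F) →ₗ[F] F} (hℓ : ℓ ≠ 0) {w : Fin n → MvPolynomial (Fin n) F}
    (hw : ∀ g : G, oneFormAct (g : GLn F n) w = fun j => C (χ g : F) * w j)
    {r : Fin n → F} (hr : ℓ r ≠ 0) {d : ℕ} (hd : linToPoly ℓ ^ d ∣ contract w r)
    {t : G} (ht : ∀ v, ℓ v = 0 → (t : GLn F n) v = v) (htr : IsTransvection (t : GLn F n))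
    (v : Fin n → F) :
    linToPoly ℓ ^ (d + 1) ∣ contract w ((t : GLn F n) v - v) := by
  have hv : (t : GLn F n) v - v = (ℓ v / ℓ r) • ((t : GLn F n) r - r) := by
    have := ht (v - (ℓ v / ℓ r) • r) (by simp [hr])
    rw [map_sub, map_smul, sub_eq_iff_eq_add] at this
    rw [this, smul_sub]
    abel
  have hsub : contract w ((t : GLn F n) r - r) =
      polyAct (t : GLn F n) (contract w r) - contract w r := by
    rw [polyAct_contract (hw t), map_eq_one_of_isTransvection χ hℓ ht htr, Units.val_one, C_1,
      one_mul, eq_sub_iff_add_eq, ← contract_add, sub_add_cancel]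
  have hl : polyAct (t : GLn F n) (linToPoly ℓ) = linToPoly ℓ := by
    simpa [htr.2.1] using C_det_mul_polyAct_linToPoly hℓ ht
  obtain ⟨q, hq⟩ := hd
  rw [hv, contract_smul, hsub, hq, map_mul, map_pow, hl, ← mul_sub, pow_succ]
  exact (mul_dvd_mul_left _ (linToPoly_dvd_polyAct_sub hℓ ht q)).mul_left _

/-- The local divisibility at a single reflecting hyperplane `H = ker ℓ`. -/
lemma pow_dvd_det_of_hyperplane {G : Subgroup (GLn F n)} (χ : G →* Fˣ)
    {H : Submodule F (Fin n → F)} {ℓ : (Fin n → F) →ₗ[F] F} (hℓ : ℓ ≠ 0)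
    (hker : LinearMap.ker ℓ = H) (s : G) (hs : (s : GLn F n) ∈ pointStab G H)
    (hord : orderOf (s : GLn F n) = eH G H)
    (hord' : orderOf (LinearMap.det (s : GLn F n).toLinearMap) = eH G H)
    {a a' : ℕ} (ha : ∀ m < a, (χ s : F) * LinearMap.det (s : GLn F n).toLinearMap ^ m ≠ 1)
    (hdet_pow : (χ s : F) * LinearMap.det (s : GLn F n).toLinearMap ^ (a' + 1) = 1)
    (ha' : ∀ m < a', (χ s : F) * LinearMap.det (s : GLn F n).toLinearMap ^ (m + 1) ≠ 1)
    [Decidable (χ s = 1)] (ω : Fin n → Fin n → MvPolynomial (Fin n) F)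
    (hω : ∀ i, ∀ g : G, oneFormAct (g : GLn F n) (ω i) = fun j => C (χ g : F) * ω i j) :
    linToPoly ℓ ^ ((if χ s = 1 then eH G H * bH G H else 0) + a * (n - 1) + a') ∣
      Matrix.det (Matrix.of fun i j => ω i j) := by
  have hfix : ∀ g ∈ pointStab G H, ∀ v, ℓ v = 0 → g v = v := fun g hg v hv =>
    hg.2 v (by rwa [← hker, LinearMap.mem_ker])
  have hdet : LinearMap.det (s : GLn F n).toLinearMap = 1 → (s : GLn F n) = 1 := fun h => by
    rw [← orderOf_eq_one_iff, hord, ← hord', h, orderOf_one]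
  obtain ⟨r, hr, hsr⟩ := exists_eigenvector hℓ (hfix _ hs) hdet
  have hωr : ∀ i, linToPoly ℓ ^ a' ∣ contract (ω i) r := fun i => by
    refine linToPoly_pow_dvd_of_semiinvariant hℓ (hfix _ hs) a'
      ((χ s : F) * LinearMap.det (s : GLn F n).toLinearMap) _ ?_ fun k hk => ?_
    · rw [polyAct_contract (hω i s), hsr, contract_smul, C_mul, mul_assoc]
    · rw [mul_assoc, ← pow_succ']
      exact ha' k hk
  split_ifs with hχ
  · have ha0 : a = 0 := by
      by_contra h
      exact ha 0 (Nat.pos_of_ne_zero h) (by simp [hχ])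
    have he : eH G H ≤ a' + 1 := by
      rw [hχ, Units.val_one, one_mul] at hdet_pow
      exact Nat.le_of_dvd a'.succ_pos (hord' ▸ orderOf_dvd_of_pow_eq_one hdet_pow)
    let D : Fin n → Submodule F (Fin n → F) := fun i =>
      { carrier := {u | linToPoly ℓ ^ eH G H ∣ contract (ω i) u}
        add_mem' := fun {u v} hu hv => by
          rw [Set.mem_ofPred_eq, contract_add]
          exact dvd_add hu hv
        zero_mem' := by simp [contract]
        smul_mem' := fun c u hu => by
          rw [Set.mem_ofPred_eq, contract_smul]
          exact Dvd.dvd.mul_left hu _ }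
    have hD : ∀ i, trvSpace G H ≤ D i := fun i => by
      refine iSup₂_le fun t ht => ?_
      rintro _ ⟨v, rfl⟩
      exact (pow_dvd_pow _ he).trans (pow_dvd_contract_of_isTransvection χ hℓ (hω i) hr (hωr i)
        (t := ⟨t, ht.1.1⟩) (hfix t ht.1) ht.2 v)
    have hH : trvSpace G H ≤ LinearMap.ker ℓ := by
      refine iSup₂_le fun t ht => ?_
      rintro _ ⟨v, rfl⟩
      have := apply_eq_det_mul hℓ (hfix t ht.1) v
      rw [ht.2.2.1, one_mul] at this
      simp [this]
    have := pow_dvd_det_of_subspace ω (linToPoly ℓ) (trvSpace G H) r (fun h => hr (hH h))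
      (eH G H) a' (fun i u hu => hD i hu) hωr
    simpa [ha0, bH] using this
  · have hrank : Module.finrank F (LinearMap.ker ℓ) = n - 1 := by
      have := ℓ.finrank_range_add_finrank_ker
      rw [LinearMap.range_eq_top.mpr (LinearMap.surjective hℓ), finrank_top, Module.finrank_self,
        Module.finrank_fin_fun] at this
      omega
    rw [zero_add, ← hrank]
    refine pow_dvd_det_of_subspace ω (linToPoly ℓ) (LinearMap.ker ℓ) r hr a a'
      (fun i u hu => ?_) hωr
    refine linToPoly_pow_dvd_of_semiinvariant hℓ (hfix _ hs) a (χ s : F) _ ?_ ha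
    rw [polyAct_contract (hω i s), hfix _ hs u hu]

/-- χ-analogue of the divisibility lemma. For χ-invariant 1-forms
`ω₁,…,ωₙ`, the polynomial `Q(Ã_χ)·Q_χ^{n-1}·Q_{χ·det}` divides the polynomial `f`
with `ω₁ ∧ ⋯ ∧ ωₙ = f · vol`. Here `sH H` is a diagonalizable reflection in `G_H` of
maximal order `e_H`, `a H = a_H(χ)` is least with `χ(s_H) = det(s_H)^{-a_H}`, `a' H`
is the analogous exponent for `χ·det`, and `Aχ = {H ∈ A : χ(s_H) = 1}`. -/
theorem stmt16 {F : Type*} [Field F] (h2 : ringChar F ≠ 2) {n : ℕ}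
    (G : Subgroup (GLn F n)) [Finite G]
    (hrefl : Subgroup.closure {g : GLn F n | g ∈ G ∧ IsReflection g} = G)
    (A : Finset (Submodule F (Fin n → F)))
    (hA : ∀ H, H ∈ A ↔ ∃ g ∈ G, IsReflection g ∧ fixedSpace g = H)
    (ℓ : Submodule F (Fin n → F) → ((Fin n → F) →ₗ[F] F))
    (hℓ : ∀ H ∈ A, ℓ H ≠ 0 ∧ LinearMap.ker (ℓ H) = H)
    (χ : G →* Fˣ)
    (sH : Submodule F (Fin n → F) → G)
    (hsH : ∀ H ∈ A, (sH H : GLn F n) ∈ pointStab G H ∧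
      orderOf (sH H : GLn F n) = eH G H ∧
      orderOf (LinearMap.det (sH H : GLn F n).toLinearMap) = eH G H ∧
      ((sH H : GLn F n) = 1 ∨ IsReflection (sH H : GLn F n)))
    (a a' : Submodule F (Fin n → F) → ℕ)
    (ha : ∀ H ∈ A,
      (χ (sH H) : F) * LinearMap.det (sH H : GLn F n).toLinearMap ^ a H = 1 ∧
      ∀ m < a H, (χ (sH H) : F) * LinearMap.det (sH H : GLn F n).toLinearMap ^ m ≠ 1)
    (ha' : ∀ H ∈ A,
      (χ (sH H) : F) * LinearMap.det (sH H : GLn F n).toLinearMap ^ (a' H + 1) = 1 ∧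
      ∀ m < a' H, (χ (sH H) : F) * LinearMap.det (sH H : GLn F n).toLinearMap ^ (m + 1) ≠ 1)
    (Aχ : Finset (Submodule F (Fin n → F)))
    (hAχ : ∀ H, H ∈ Aχ ↔ H ∈ A ∧ χ (sH H) = 1)
    (ω : Fin n → Fin n → MvPolynomial (Fin n) F)
    (hω : ∀ i, ∀ g : G, oneFormAct (g : GLn F n) (ω i) = fun j => C (χ g : F) * ω i j) :
    ((∏ H ∈ Aχ, linToPoly (ℓ H) ^ (eH G H * bH G H)) *
        (∏ H ∈ A, linToPoly (ℓ H) ^ a H) ^ (n - 1) *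
        ∏ H ∈ A, linToPoly (ℓ H) ^ a' H) ∣
      Matrix.det (Matrix.of fun i j => ω i j) := by
  classical
  have hAeq : Aχ = A.filter fun H => χ (sH H) = 1 := by
    ext H
    simp [hAχ]
  rw [hAeq, Finset.prod_filter, ← Finset.prod_pow, ← Finset.prod_mul_distrib,
    ← Finset.prod_mul_distrib]
  refine Finset.prod_dvd_of_isRelPrime (fun H hH H' hH' hne => ?_) fun H hH => ?_
  · have h : ∀ H, (if χ (sH H) = 1 then linToPoly (ℓ H) ^ (eH G H * bH G H) else 1) *
        (linToPoly (ℓ H) ^ a H) ^ (n - 1) * linToPoly (ℓ H) ^ a' H =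
        linToPoly (ℓ H) ^ ((if χ (sH H) = 1 then eH G H * bH G H else 0) +
          a H * (n - 1) + a' H) := fun H => by
      split_ifs <;> simp [pow_add, pow_mul]
    simp only [Function.onFun, h]
    refine (isRelPrime_linToPoly (hℓ H hH).1 (hℓ H' hH').1 ?_).pow
    rwa [(hℓ H hH).2, (hℓ H' hH').2]
  · obtain ⟨hs, hord, hord', -⟩ := hsH H hH
    have := pow_dvd_det_of_hyperplane χ (hℓ H hH).1 (hℓ H hH).2 (sH H) hs hord hord' (ha H hH).2
      (ha' H hH).1 (ha' H hH).2 ω hω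
    convert this using 1
    split_ifs <;> simp [pow_add, pow_mul]
end
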